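/- If T is a tree that is not a path, then ξ(T) = 2; if T is a path on at least one vertex, then ξ(T) = 1. In particular, ξ(T) ≤ 2 for every tree T. -/

import Mathlib

/-- The Strong Arnold Property. -/
def HasSAP {V : Type*} [Fintype V] [DecidableEq V] (A : Matrix V V ℝ) : Prop :=
  ∀ X : Matrix V V ℝ, X.IsSymm → (∀ i, X i i = 0) →
    (∀ i j, i ≠ j → A i j ≠ 0 → X i j = 0) → A * X = 0 → X = 0

/-- `A ∈ S(G)`. -/
def InS {V : Type*} [Fintype V] [DecidableEq V] (G : SimpleGraph V)
    (A : Matrix V V ℝ) : Prop :=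
  A.IsSymm ∧ ∀ i j, i ≠ j → (A i j ≠ 0 ↔ G.Adj i j)

/-- Nullity of a square real matrix. -/
noncomputable def nullity {V : Type*} [Fintype V] [DecidableEq V]
    (A : Matrix V V ℝ) : ℕ :=
  Fintype.card V - A.rank

/-- Maximum nullity over `S(G)`. -/
noncomputable def MaxNull {V : Type*} [Fintype V] [DecidableEq V]
    (G : SimpleGraph V) : ℕ :=
  sSup {k | ∃ A : Matrix V V ℝ, InS G A ∧ nullity A = k}

/-- The Colin de Verdière type parameter `ξ(G)`. -/
noncomputable def xi {V : Type*} [Fintype V] [DecidableEq V]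
    (G : SimpleGraph V) : ℕ :=
  sSup {k | ∃ A : Matrix V V ℝ, InS G A ∧ HasSAP A ∧ nullity A = k}

namespace SimpleGraph

variable {V : Type*} {T : SimpleGraph V} {v w x u i j : V}

/-- The component containing `w` of the graph obtained by deleting the edge `vw`. -/
def branch (T : SimpleGraph V) (v w : V) : Set V :=
  {u | (T.deleteEdges {s(v, w)}).Reachable w u}

lemma self_mem_branch : w ∈ T.branch v w := Reachable.refl _

lemma IsAcyclic.notMem_branch (hT : T.IsAcyclic) (h : T.Adj v w) : v ∉ T.branch v w :=
  fun hv => isBridge_iff.1 (isAcyclic_iff_forall_adj_isBridge.1 hT h) (Reachable.symm hv)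

/-- The only edge leaving a branch at `v` is the edge to `v`. -/
lemma IsAcyclic.eq_of_adj_of_mem_branch (hT : T.IsAcyclic) (h : T.Adj v w)
    (hi : i ∈ T.branch v w) (hj : j ∉ T.branch v w) (hij : T.Adj i j) : i = w ∧ j = v := by
  by_cases he : s(i, j) = s(v, w)
  · rcases Sym2.eq_iff.1 he with ⟨rfl, rfl⟩ | ⟨rfl, rfl⟩
    · exact (hT.notMem_branch h hi).elim
    · exact ⟨rfl, rfl⟩
  · refine (hj (Reachable.trans hi (Adj.reachable ?_))).elim
    rw [deleteEdges_adj]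
    exact ⟨hij, he⟩

lemma IsAcyclic.notMem_branch_swap (hT : T.IsAcyclic) (h : T.Adj v w)
    (hu : u ∈ T.branch v w) : u ∉ T.branch w v := fun hu' => by
  rw [branch, Set.mem_ofPred_eq, Sym2.eq_swap] at hu'
  exact hT.notMem_branch h (Reachable.trans hu hu'.symm)

lemma IsTree.mem_branch_swap_of_notMem (hT : T.IsTree) (h : T.Adj v w)
    (hu : u ∉ T.branch v w) : u ∈ T.branch w v := by
  have step : ∀ a b, T.Adj a b → b ∈ T.branch v w ∪ T.branch w v →
      a ∈ T.branch v w ∪ T.branch w v := by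
    intro a b hab hb
    by_contra ha
    rw [Set.mem_union, not_or] at ha
    rcases hb with hb | hb
    · obtain ⟨-, rfl⟩ := hT.isAcyclic.eq_of_adj_of_mem_branch h hb ha.1 hab.symm
      exact ha.2 self_mem_branch
    · obtain ⟨-, rfl⟩ := hT.isAcyclic.eq_of_adj_of_mem_branch h.symm hb ha.2 hab.symm
      exact ha.1 self_mem_branch
  have walk : ∀ a b, T.Walk a b → b ∈ T.branch v w ∪ T.branch w v →
      a ∈ T.branch v w ∪ T.branch w v := by
    intro a b p hb
    induction p with
    | nil => exact hb
    | cons hab _ ih => exact step _ _ hab (ih hb)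
  obtain ⟨p⟩ := hT.connected.preconnected u v
  exact (walk u v p (Or.inr self_mem_branch)).resolve_left hu

lemma IsAcyclic.disjoint_branch (hT : T.IsAcyclic) (hw : T.Adj v w) (hx : T.Adj v x)
    (hne : w ≠ x) : Disjoint (T.branch v w) (T.branch v x) := by
  rw [Set.disjoint_left]
  intro u hu
  have aux : ∀ a, a ∉ T.branch v x → a ∈ T.branch v w →
      ∀ p : (T.deleteEdges {s(v, w)}).Walk a u, u ∉ T.branch v x := by
    intro a ha haw p
    induction p with
    | nil => exact ha
    | @cons a b c hab p ih =>
      have hb : b ∈ T.branch v w := Reachable.trans haw hab.reachable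
      refine ih hu (fun hbx => ?_) hb
      have := (hT.eq_of_adj_of_mem_branch hx hbx ha (hab.1).symm).2
      exact hT.notMem_branch hw (this ▸ haw)
  obtain ⟨p⟩ : (T.deleteEdges {s(v, w)}).Reachable w u := hu
  refine aux w (fun hwx => ?_) self_mem_branch p
  exact hne (hT.eq_of_adj_of_mem_branch hx hwx (hT.notMem_branch hx) hw.symm).1

lemma IsTree.branch_ssubset (hT : T.IsTree) (h : T.Adj v w) (hx : T.Adj w x) (hne : x ≠ v) :
    T.branch w x ⊂ T.branch v w := by
  refine ⟨fun u hu => ?_, fun hs => hT.isAcyclic.notMem_branch hx (hs self_mem_branch)⟩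
  by_contra hu'
  exact Set.disjoint_left.1 (hT.isAcyclic.disjoint_branch hx h.symm hne) hu
    (hT.mem_branch_swap_of_notMem h hu')

lemma Connected.exists_mem_branch (hT : T.Connected) (hne : u ≠ v) :
    ∃ w, T.Adj v w ∧ u ∈ T.branch v w := by
  classical
  obtain ⟨p, hp⟩ := (hT.preconnected v u).exists_isPath
  cases p with
  | nil => exact (hne rfl).elim
  | @cons _ w _ h p =>
    rw [Walk.cons_isPath_iff] at hp
    refine ⟨w, h, ⟨p.toDeleteEdges _ fun e he hev => ?_⟩⟩
    rw [Set.mem_singleton_iff] at hev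
    exact hp.2 (p.fst_mem_support_of_mem_edges (hev ▸ he))

/-- If every edge of a finite tree is oriented in at most one direction,
then some vertex has no outgoing edge. -/
lemma IsTree.exists_forall_adj_not [Finite V] (hT : T.IsTree) (L : V → V → Prop)
    (hL : ∀ v w, T.Adj v w → L v w → ¬ L w v) : ∃ v, ∀ w, T.Adj v w → ¬ L v w := by
  by_contra! hcon
  obtain ⟨v₀⟩ := hT.connected.nonempty
  obtain ⟨w₀, h₀⟩ := hcon v₀
  obtain ⟨e, he, hmin⟩ := (Set.toFinite {e : V × V | T.Adj e.1 e.2 ∧ L e.1 e.2}).exists_minimalFor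
    (fun e => T.branch e.1 e.2) _ ⟨(v₀, w₀), h₀⟩
  obtain ⟨x, hx, hLx⟩ := hcon e.2
  have hxe : x ≠ e.1 := by
    rintro rfl
    exact hL _ _ he.1 he.2 hLx
  have hss := hT.branch_ssubset he.1 hx hxe
  exact hss.2 (hmin (j := (e.2, x)) ⟨hx, hLx⟩ hss.1)

end SimpleGraph

open SimpleGraph in
/-- A tree in which no vertex has three neighbours is a path. -/
lemma SimpleGraph.IsTree.exists_iso_pathGraph {V : Type*} [Finite V] {T : SimpleGraph V}
    (hT : T.IsTree)
    (hdeg : ∀ v a b c, T.Adj v a → T.Adj v b → T.Adj v c → a = b ∨ a = c ∨ b = c) :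
    ∃ m : ℕ, Nonempty (T ≃g pathGraph m) := by
  classical
  have := Fintype.ofFinite V
  obtain ⟨v₀⟩ := hT.connected.nonempty
  let P (n : ℕ) : Prop := ∃ (u v : V) (p : T.Walk u v), p.IsPath ∧ p.length = n
  have hb : ∀ n, P n → n ≤ Fintype.card V := by
    rintro n ⟨u, v, p, hp, rfl⟩
    exact hp.length_lt.le
  obtain ⟨u, v, p, hp, hlen⟩ : P (Nat.findGreatest P (Fintype.card V)) :=
    Nat.findGreatest_spec (m := 0) (Nat.zero_le _) ⟨v₀, v₀, .nil, .nil, rfl⟩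
  have hmax : ∀ {a b : V} (q : T.Walk a b), q.IsPath → q.length ≤ p.length := by
    intro a b q hq
    rw [hlen]
    exact Nat.le_findGreatest (hb _ ⟨a, b, q, hq, rfl⟩) ⟨a, b, q, hq, rfl⟩
  have hclosed : ∀ i ≤ p.length, ∀ y, T.Adj (p.getVert i) y → y ∈ p.support := by
    intro i hi y hy
    by_contra hys
    rcases Nat.eq_zero_or_pos i with rfl | h0
    · rw [Walk.getVert_zero] at hy
      have := hmax (Walk.cons hy.symm p) (hp.cons hys)
      simp at this
    · rcases hi.eq_or_lt with rfl | hlt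
      · rw [Walk.getVert_length] at hy
        have := hmax (p.concat hy) (hp.concat hys hy)
        simp at this
      · obtain ⟨k, rfl⟩ : ∃ k, i = k + 1 := ⟨i - 1, by omega⟩
        have h1 := (p.adj_getVert_succ (i := k) (by omega)).symm
        have h2 := p.adj_getVert_succ hlt
        rcases hdeg _ _ _ _ h1 h2 hy with h | h | h
        · have := hp.getVert_injOn (by simp; omega) (by simp; omega) h
          omega
        · exact hys (h ▸ p.getVert_mem_support _)
        · exact hys (h ▸ p.getVert_mem_support _)
  have hall : ∀ y, y ∈ p.support := by
    intro y
    obtain ⟨q⟩ := hT.connected.preconnected y u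
    have aux : ∀ {a b : V}, T.Walk a b → b ∈ p.support → a ∈ p.support := by
      intro a b q hb
      induction q with
      | nil => exact hb
      | cons h q ih =>
        obtain ⟨i, hi, hle⟩ := Walk.mem_support_iff_exists_getVert.1 (ih hb)
        exact hclosed i hle _ (hi ▸ h.symm)
    exact aux q p.start_mem_support
  have hadj : ∀ i j, i < j → j ≤ p.length → T.Adj (p.getVert i) (p.getVert j) → i + 1 = j := by
    intro i j hij hj h
    obtain ⟨q, hq, hql⟩ : ∃ q : T.Walk (p.getVert i) (p.getVert j), q.IsPath ∧ q.length = j - i := by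
      have hv : (p.drop i).getVert (j - i) = p.getVert j := by
        rw [Walk.drop_getVert]; congr 1; omega
      refine ⟨((p.drop i).take (j - i)).copy rfl hv, ?_, ?_⟩
      · rw [Walk.isPath_copy]
        exact (hp.drop i).take _
      · rw [Walk.length_copy, Walk.take_length, Walk.drop_length]
        omega
    have := (hT.isAcyclic.subsingleton_path _ _).elim ⟨q, hq⟩ (Path.singleton h)
    have := congrArg (fun r => r.1.length) this
    simp [Path.singleton] at this
    omega
  refine ⟨p.length + 1, ⟨RelIso.symm (RelIso.mk
    (Equiv.ofBijective (fun i : Fin (p.length + 1) => p.getVert i) ⟨?_, ?_⟩) ?_)⟩⟩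
  · intro i j h
    exact Fin.ext (hp.getVert_injOn (by simp; omega) (by simp; omega) h)
  · intro y
    obtain ⟨i, hi, hle⟩ := Walk.mem_support_iff_exists_getVert.1 (hall y)
    exact ⟨⟨i, by omega⟩, hi⟩
  · intro i j
    change T.Adj (p.getVert i) (p.getVert j) ↔ _
    rw [pathGraph_adj]
    constructor
    · intro h
      rcases lt_trichotomy i.1 j.1 with hij | hij | hij
      · exact Or.inl (hadj _ _ hij (by omega) h)
      · exact (h.ne (by rw [hij])).elim
      · exact Or.inr (hadj _ _ hij (by omega) h.symm)
    · rintro (h | h)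
      · exact h ▸ p.adj_getVert_succ (by omega)
      · exact h ▸ (p.adj_getVert_succ (by omega)).symm

open Matrix

section Nullity

variable {V : Type*} [Fintype V] [DecidableEq V]

lemma nullity_eq_finrank_ker (A : Matrix V V ℝ) :
    nullity A = Module.finrank ℝ (LinearMap.ker A.mulVecLin) := by
  have := A.mulVecLin.finrank_range_add_finrank_ker
  rw [Module.finrank_fintype_fun_eq_card] at this
  rw [nullity, Matrix.rank]
  omega

/-- Fewer linear conditions than the nullity have a nonzero common solution in the kernel. -/
lemma exists_ne_zero_of_lt_nullity {A : Matrix V V ℝ} {n : ℕ} (hn : n < nullity A)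
    (e : Fin n → V) : ∃ x : V → ℝ, x ≠ 0 ∧ A *ᵥ x = 0 ∧ ∀ i, x (e i) = 0 := by
  let f : LinearMap.ker A.mulVecLin →ₗ[ℝ] Fin n → ℝ :=
    (LinearMap.funLeft ℝ ℝ e).comp (Submodule.subtype _)
  have hf : LinearMap.ker f ≠ ⊥ := LinearMap.ker_ne_bot_of_finrank_lt (by
    rwa [Module.finrank_fin_fun, ← nullity_eq_finrank_ker])
  obtain ⟨⟨x, hx⟩, hxf, hx0⟩ := Submodule.exists_mem_ne_zero_of_ne_bot hf
  exact ⟨x, fun h => hx0 (Subtype.ext h), hx, fun i => congrFun hxf i⟩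

lemma HasSAP.eq_zero_or_eq_zero {A : Matrix V V ℝ} (hA : HasSAP A) {p y : V → ℝ}
    (hp : A *ᵥ p = 0) (hy : A *ᵥ y = 0)
    (hpy : ∀ i j, p i ≠ 0 → y j ≠ 0 → i ≠ j ∧ A i j = 0 ∧ A j i = 0) : p = 0 ∨ y = 0 := by
  by_contra! h
  obtain ⟨i, hi⟩ := Function.ne_iff.1 h.1
  obtain ⟨j, hj⟩ := Function.ne_iff.1 h.2
  have hprod : ∀ a b, (a = b ∨ A a b ≠ 0 ∨ A b a ≠ 0) → p a * y b = 0 := by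
    intro a b hab
    by_contra hne
    have := hpy a b (left_ne_zero_of_mul hne) (right_ne_zero_of_mul hne)
    tauto
  have hX := hA (vecMulVec p y + vecMulVec y p) ?_ ?_ ?_ ?_
  · have h1 := congrFun (congrFun hX i) j
    have h2 : y i = 0 := (mul_eq_zero.1 (hprod i i (Or.inl rfl))).resolve_left hi
    simp [vecMulVec_apply, h2] at h1
    exact h1.elim hi hj
  · ext a b
    simp [vecMulVec_apply]
    ring
  · intro a
    have := hprod a a (Or.inl rfl)
    simp [vecMulVec_apply]
    linarith
  · intro a b _ hab
    have h1 := hprod a b (Or.inr (Or.inl hab))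
    have h2 := hprod b a (Or.inr (Or.inr hab))
    simp [vecMulVec_apply]
    linarith
  · rw [Matrix.mul_add, mul_vecMulVec, mul_vecMulVec, hp, hy]
    simp

variable {T : SimpleGraph V} {A : Matrix V V ℝ}

lemma InS.eq_zero (hA : InS T A) {i j : V} (hij : i ≠ j) (h : ¬ T.Adj i j) : A i j = 0 := by
  by_contra h0
  exact h ((hA.2 i j hij).1 h0)

lemma InS.ne_zero (hA : InS T A) {i j : V} (h : T.Adj i j) : A i j ≠ 0 :=
  (hA.2 i j h.ne).2 h

/-- Cutting a kernel vector that vanishes at `v` down to a branch at `v` only affects the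
equation at `v`. -/
lemma InS.mulVec_indicator_branch (hA : InS T A) (hT : T.IsAcyclic) {v w : V} (hw : T.Adj v w)
    {x : V → ℝ} (hx : A *ᵥ x = 0) (hv : x v = 0) :
    A *ᵥ (T.branch v w).indicator x = Pi.single v (A v w * x w) := by
  classical
  ext u
  by_cases hu : u ∈ T.branch v w
  · have huv : u ≠ v := by rintro rfl; exact hT.notMem_branch hw hu
    rw [Pi.single_eq_of_ne huv, ← show (A *ᵥ x) u = 0 from congrFun hx u]
    refine Finset.sum_congr rfl fun j _ => ?_
    by_cases hj : j ∈ T.branch v w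
    · rw [Set.indicator_of_mem hj]
    · rw [Set.indicator_of_notMem hj, mul_zero]
      by_cases huj : T.Adj u j
      · rw [(hT.eq_of_adj_of_mem_branch hw hu hj huj).2, hv, mul_zero]
      · exact (mul_eq_zero_of_left (hA.eq_zero (by rintro rfl; exact hj hu) huj) _).symm
  · have hz : ∀ j, j ≠ w ∨ u ≠ v → A u j * (T.branch v w).indicator x j = 0 := by
      intro j hju
      by_cases hj : j ∈ T.branch v w
      · rw [hA.eq_zero (by rintro rfl; exact hu hj), zero_mul]
        intro huj
        have := hT.eq_of_adj_of_mem_branch hw hj hu huj.symm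
        tauto
      · rw [Set.indicator_of_notMem hj, mul_zero]
    by_cases huv : u = v
    · subst huv
      rw [Pi.single_eq_same]
      refine (Finset.sum_eq_single w (fun j _ hj => hz j (Or.inl hj)) (by simp)).trans ?_
      rw [Set.indicator_of_mem SimpleGraph.self_mem_branch]
    · rw [Pi.single_eq_of_ne huv]
      exact Finset.sum_eq_zero fun j _ => hz j (Or.inr huv)

/-- A matrix with the Strong Arnold Property whose graph is a tree has nullity at most two. -/
theorem HasSAP.nullity_le_two (hsap : HasSAP A) (hA : InS T A) (hT : T.IsTree) :
    nullity A ≤ 2 := by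
  by_contra! hn
  have hac := hT.isAcyclic
  have sep : ∀ (S : Set V) {i j : V}, (i ∈ S → j ∉ S → ¬ T.Adj i j) → i ∈ S → j ∉ S →
      i ≠ j ∧ A i j = 0 ∧ A j i = 0 := by
    intro S i j h hi hj
    have hij : i ≠ j := by rintro rfl; exact hj hi
    exact ⟨hij, hA.eq_zero hij (h hi hj), hA.eq_zero hij.symm fun h' => h hi hj h'.symm⟩
  let L (v w : V) : Prop :=
    ∃ x : V → ℝ, x ≠ 0 ∧ A *ᵥ x = 0 ∧ ∀ i, x i ≠ 0 → i ∈ T.branch v w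
  have hL0 : ∀ {v w : V} {x : V → ℝ}, T.Adj v w → A *ᵥ x = 0 →
      (∀ i, x i ≠ 0 → i ∈ T.branch v w) → x w = 0 := by
    intro v w x h hx hxs
    have hxv : x v = 0 := by
      by_contra h0
      exact hac.notMem_branch h (hxs v h0)
    have h1 := hA.mulVec_indicator_branch hac h hx hxv
    rw [show (T.branch v w).indicator x = x from
      Set.indicator_eq_self.2 fun i hi => hxs i hi, hx] at h1
    have h2 := congrFun h1 v
    rw [Pi.single_eq_same, Pi.zero_apply, eq_comm] at h2
    exact (mul_eq_zero.1 h2).resolve_left (hA.ne_zero h)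
  obtain ⟨v, hv⟩ := hT.exists_forall_adj_not L (by
    rintro v w h ⟨x, hx0, hx, hxs⟩ ⟨y, hy0, hy, hys⟩
    refine (hsap.eq_zero_or_eq_zero hx hy fun i j hi hj => ?_).elim hx0 hy0
    have hjn : j ∉ T.branch v w := fun hj' => hac.notMem_branch_swap h hj' (hys j hj)
    refine sep (T.branch v w) (fun hi' hj' hadj => hi ?_) (hxs i hi) hjn
    rw [(hac.eq_of_adj_of_mem_branch h hi' hj' hadj).1]
    exact hL0 h hx hxs)
  -- No nonzero kernel vector lives on a single branch at `v`.
  have hbr : ∀ {w : V} {x : V → ℝ}, T.Adj v w → A *ᵥ x = 0 → x v = 0 → x w = 0 →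
      (T.branch v w).indicator x = 0 := by
    intro w x h hx hxv hxw
    by_contra hne
    refine hv w h ⟨_, hne, ?_, fun i hi => Set.mem_of_indicator_ne_zero hi⟩
    rw [hA.mulVec_indicator_branch hac h hx hxv, hxw, mul_zero, Pi.single_zero]
  have hnbr : ∀ {x : V → ℝ}, x ≠ 0 → A *ᵥ x = 0 → x v = 0 → ∃ w, T.Adj v w ∧ x w ≠ 0 := by
    intro x hx0 hx hxv
    obtain ⟨i, hi⟩ := Function.ne_iff.1 hx0
    obtain ⟨w, hw, hiw⟩ := hT.connected.exists_mem_branch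
      (show i ≠ v by rintro rfl; exact hi hxv)
    refine ⟨w, hw, fun hxw => hi ?_⟩
    rw [← Set.indicator_of_mem hiw x, hbr hw hx hxv hxw]
  obtain ⟨x, hx0, hx, hxv⟩ := exists_ne_zero_of_lt_nullity (show 1 < nullity A by omega) ![v]
  replace hxv : x v = 0 := hxv 0
  obtain ⟨a, ha, hxa⟩ := hnbr hx0 hx hxv
  have hzero : ∀ y : V → ℝ, A *ᵥ y = 0 → y v = 0 := by
    intro y hy
    have h1 : y ⬝ᵥ A *ᵥ (T.branch v a).indicator x = 0 := by
      rw [dotProduct_mulVec, ← mulVec_transpose, hA.1.eq, hy, zero_dotProduct]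
    rw [hA.mulVec_indicator_branch hac ha hx hxv, dotProduct_single] at h1
    exact (mul_eq_zero.1 h1).resolve_right (mul_ne_zero (hA.ne_zero ha) hxa)
  obtain ⟨b, hb, hba, hxb⟩ : ∃ b, T.Adj v b ∧ b ≠ a ∧ x b ≠ 0 := by
    by_contra! hcon
    have h1 : ∑ j, A v j * x j = A v a * x a := by
      refine Finset.sum_eq_single a (fun j _ hj => ?_) fun h => (h (Finset.mem_univ a)).elim
      by_cases hvj : v = j
      · rw [← hvj, hxv, mul_zero]
      · by_cases hadj : T.Adj v j
        · rw [hcon j hadj hj, mul_zero]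
        · rw [hA.eq_zero hvj hadj, zero_mul]
    replace h1 := h1.symm.trans (congrFun hx v)
    exact mul_ne_zero (hA.ne_zero ha) hxa h1
  have hdis := hac.disjoint_branch ha hb hba.symm
  let p : V → ℝ := (A v b * x b) • (T.branch v a).indicator x -
    (A v a * x a) • (T.branch v b).indicator x
  have hp : A *ᵥ p = 0 := by
    rw [mulVec_sub, mulVec_smul, mulVec_smul, hA.mulVec_indicator_branch hac ha hx hxv,
      hA.mulVec_indicator_branch hac hb hx hxv, ← Pi.single_smul, ← Pi.single_smul,
      smul_eq_mul, smul_eq_mul, mul_comm, sub_self]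
  have hp0 : p ≠ 0 := by
    intro h
    have h1 := congrFun h a
    simp only [p, Pi.sub_apply, Pi.smul_apply, Pi.zero_apply, smul_eq_mul,
      Set.indicator_of_mem (SimpleGraph.self_mem_branch (T := T) (v := v) (w := a)),
      Set.indicator_of_notMem (Set.disjoint_left.1 hdis SimpleGraph.self_mem_branch),
      mul_zero, sub_zero] at h1
    exact mul_ne_zero (mul_ne_zero (hA.ne_zero hb) hxb) hxa h1
  have hps : ∀ i, p i ≠ 0 → i ∈ T.branch v a ∪ T.branch v b := by
    intro i hi
    by_contra hni
    rw [Set.mem_union, not_or] at hni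
    simp [p, hni.1, hni.2] at hi
  obtain ⟨y, hy0, hy, hyab⟩ := exists_ne_zero_of_lt_nullity hn ![a, b]
  have hyv := hzero y hy
  have hys : ∀ i ∈ T.branch v a ∪ T.branch v b, y i = 0 := by
    rintro i (hi | hi)
    · rw [← Set.indicator_of_mem hi y, hbr ha hy hyv (hyab 0), Pi.zero_apply]
    · rw [← Set.indicator_of_mem hi y, hbr hb hy hyv (hyab 1), Pi.zero_apply]
  refine (hsap.eq_zero_or_eq_zero hp hy fun i j hi hj => ?_).elim hp0 hy0
  refine sep _ (fun hi' hj' hadj => hj ?_) (hps i hi) fun hj' => hj (hys j hj')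
  rw [Set.mem_union, not_or] at hj'
  rcases hi' with hi' | hi'
  · rw [(hac.eq_of_adj_of_mem_branch ha hi' hj'.1 hadj).2, hyv]
  · rw [(hac.eq_of_adj_of_mem_branch hb hi' hj'.2 hadj).2, hyv]

/-- A matrix whose graph is a path has nullity at most one. -/
theorem InS.nullity_le_one_of_iso_pathGraph (hA : InS T A) {m : ℕ}
    (f : T ≃g SimpleGraph.pathGraph m) (hm : 1 ≤ m) : nullity A ≤ 1 := by
  by_contra! hn
  obtain ⟨x, hx0, hx, hxe⟩ := exists_ne_zero_of_lt_nullity hn ![f.symm ⟨0, hm⟩]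
  replace hxe : x (f.symm ⟨0, hm⟩) = 0 := hxe 0
  have key : ∀ k, ∀ hk : k < m, x (f.symm ⟨k, hk⟩) = 0 := by
    intro k
    induction k using Nat.strong_induction_on with
    | _ k ih =>
      intro hk
      rcases Nat.eq_zero_or_pos k with rfl | hpos
      · exact hxe
      · have hadj : T.Adj (f.symm ⟨k - 1, by omega⟩) (f.symm ⟨k, hk⟩) := by
          rw [f.symm.map_adj_iff, SimpleGraph.pathGraph_adj]
          exact Or.inl (Nat.sub_add_cancel hpos)
        have h1 : (A *ᵥ x) (f.symm ⟨k - 1, by omega⟩) =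
            A (f.symm ⟨k - 1, by omega⟩) (f.symm ⟨k, hk⟩) * x (f.symm ⟨k, hk⟩) := by
          refine Finset.sum_eq_single _ (fun j _ hj => ?_) (by simp)
          obtain ⟨⟨l, hl⟩, rfl⟩ := f.symm.surjective j
          have hlk : l ≠ k := by rintro rfl; exact hj rfl
          rcases lt_or_gt_of_ne hlk with h | h
          · rw [ih l h hl, mul_zero]
          · refine mul_eq_zero_of_left (hA.eq_zero ?_ ?_) _
            · intro he
              have := f.symm.injective he
              simp at this
              omega
            · rw [f.symm.map_adj_iff, SimpleGraph.pathGraph_adj]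
              simp
              omega
        rw [hx, Pi.zero_apply, eq_comm] at h1
        exact (mul_eq_zero.1 h1).resolve_left (hA.ne_zero hadj)
  refine hx0 (funext fun u => ?_)
  obtain ⟨⟨k, hk⟩, rfl⟩ := f.symm.surjective u
  exact key k hk

/-- The Laplacian of a connected graph attains nullity one with the Strong Arnold Property. -/
theorem exists_hasSAP_one_le_nullity (hT : T.Connected) :
    ∃ A, InS T A ∧ HasSAP A ∧ 1 ≤ nullity A := by
  classical
  refine ⟨T.lapMatrix ℝ, ⟨T.isSymm_lapMatrix ℝ, fun i j hij => ?_⟩, fun X hX hd _ h0 => ?_, ?_⟩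
  · simp [SimpleGraph.lapMatrix, SimpleGraph.degMatrix, hij]
  · ext i j
    have hj : T.lapMatrix ℝ *ᵥ (fun u => X u j) = 0 := funext fun u => congrFun (congrFun h0 u) j
    rw [(T.lapMatrix_mulVec_eq_zero_iff_forall_reachable.1 hj) i j (hT.preconnected i j), hd,
      Matrix.zero_apply]
  · rw [nullity_eq_finrank_ker, Nat.one_le_iff_ne_zero, Ne, Submodule.finrank_eq_zero]
    obtain ⟨v⟩ := hT.nonempty
    have hmem : (fun _ => 1 : V → ℝ) ∈ LinearMap.ker (T.lapMatrix ℝ).mulVecLin :=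
      T.lapMatrix_mulVec_eq_zero_iff_forall_adj.2 fun _ _ _ => rfl
    intro h
    rw [h, Submodule.mem_bot] at hmem
    exact one_ne_zero (congrFun hmem v)

open SimpleGraph in
/-- A tree with a vertex having three neighbours attains nullity two with the
Strong Arnold Property. -/
theorem SimpleGraph.IsTree.exists_hasSAP_two_le_nullity (hT : T.IsTree) {v : V} {w : Fin 3 → V}
    (hw : ∀ i, T.Adj v (w i)) (hinj : Function.Injective w) :
    ∃ A, InS T A ∧ HasSAP A ∧ 2 ≤ nullity A := by
  classical
  have hac := hT.isAcyclic
  let G := T.deleteEdges {e | v ∈ e}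
  let C (i : Fin 3) (u : V) : Prop := G.Reachable (w i) u
  let D (u : V) : ℝ := if u ≠ v ∧ ∀ i, ¬ C i u then 1 else 0
  let N : Matrix V V ℝ := .of fun i j => if T.Adj i j ∧ (i = v ∨ j = v) then 1 else 0
  have hG : ∀ i j, G.Adj i j ↔ T.Adj i j ∧ ¬ (i = v ∨ j = v) := by
    intro i j
    simp only [G, deleteEdges_adj, Set.mem_ofPred_eq, Sym2.mem_iff, eq_comm (a := v)]
  have hCb : ∀ i u, C i u → u ∈ T.branch v (w i) := fun i u h =>
    Reachable.mono (deleteEdges_anti (by simp)) h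
  have hCv : ∀ i, ¬ C i v := fun i h => hac.notMem_branch (hw i) (hCb i v h)
  have hCadj : ∀ i u, T.Adj v u → C i u → w i = u := by
    intro i u hu h
    by_contra hne
    exact Set.disjoint_left.1 (hac.disjoint_branch (hw i) hu hne) (hCb i u h) self_mem_branch
  have hCw : ∀ i k, C i (w k) ↔ i = k :=
    fun i k => ⟨fun h => hinj (hCadj i _ (hw k) h), fun h => h ▸ Reachable.refl _⟩
  have hDC : ∀ i u, C i u → D u = 0 := fun i u h => if_neg fun h' => h'.2 i h
  let A : Matrix V V ℝ := G.lapMatrix ℝ + diagonal D - N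
  have hAsymm : A.IsSymm := by
    refine ((G.isSymm_lapMatrix ℝ).add (isSymm_diagonal _)).sub ?_
    ext i j
    simp only [N, transpose_apply, of_apply, T.adj_comm i j, or_comm]
  have hAS : InS T A := by
    refine ⟨hAsymm, fun i j hij => ?_⟩
    have : A i j = if T.Adj i j then -1 else 0 := by
      simp only [A, N, Matrix.sub_apply, Matrix.add_apply, lapMatrix, degMatrix, diagonal_apply_ne _ hij,
        adjMatrix_apply, of_apply, hG]
      by_cases h1 : T.Adj i j <;> by_cases h2 : i = v ∨ j = v <;> simp [h1, h2]
    rw [this]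
    by_cases h1 : T.Adj i j <;> simp [h1]
  have hN : ∀ x : V → ℝ, x v = 0 →
      N *ᵥ x = Pi.single v (∑ j, if T.Adj v j then x j else 0) := by
    intro x hx
    ext u
    by_cases hu : u = v
    · subst hu
      rw [Pi.single_eq_same]
      exact Finset.sum_congr rfl fun j _ => by simp [N]
    · rw [Pi.single_eq_of_ne hu]
      refine Finset.sum_eq_zero fun j _ => ?_
      by_cases hj : j = v
      · rw [hj, hx, mul_zero]
      · simp [N, hu, hj]
  have hsum : ∀ x : V → ℝ, (∀ u, D u * x u = 0) →
      (∑ j, if T.Adj v j then x j else 0) = ∑ i, x (w i) := by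
    intro x hx
    rw [← Finset.sum_image (s := Finset.univ) (f := x) (g := w) hinj.injOn, ← Finset.sum_filter]
    refine (Finset.sum_subset (fun j hj => ?_) fun j hj hjw => ?_).symm
    · obtain ⟨i, -, rfl⟩ := Finset.mem_image.1 hj
      simpa using hw i
    · have hvj : T.Adj v j := (Finset.mem_filter.1 hj).2
      have hD : D j = 1 := if_pos ⟨hvj.ne', fun i hi =>
        hjw (Finset.mem_image.2 ⟨i, Finset.mem_univ _, hCadj i j hvj hi⟩)⟩
      simpa [hD] using hx j
  have hA : ∀ x : V → ℝ, x v = 0 → (∀ i j, G.Adj i j → x i = x j) → (∀ u, D u * x u = 0) →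
      A *ᵥ x = - Pi.single v (∑ i, x (w i)) := by
    intro x hxv hxG hxD
    have h1 : diagonal D *ᵥ x = 0 := funext fun u => by rw [mulVec_diagonal, hxD, Pi.zero_apply]
    rw [sub_mulVec, add_mulVec, hN x hxv, hsum x hxD, h1,
      G.lapMatrix_mulVec_eq_zero_iff_forall_adj.2 hxG, add_zero, zero_sub]
  let z (c : Fin 3 → ℝ) (u : V) : ℝ := ∑ i, if C i u then c i else 0
  have hzw : ∀ c k, z c (w k) = c k := by
    intro c k
    simp [z, hCw]
  have hAz : ∀ c, A *ᵥ z c = - Pi.single v (∑ i, c i) := by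
    intro c
    rw [hA (z c) (by simp [z, hCv]), Finset.sum_congr rfl fun k _ => hzw c k]
    · intro i j hij
      have : ∀ k, C k i ↔ C k j := fun k =>
        ⟨fun h => h.trans hij.reachable, fun h => h.trans hij.symm.reachable⟩
      simp only [z, this]
    · intro u
      simp only [z, Finset.mul_sum]
      refine Finset.sum_eq_zero fun i _ => ?_
      by_cases h : C i u
      · rw [hDC i u h, zero_mul]
      · rw [if_neg h, mul_zero]
  have hker : ∀ x : V → ℝ, A *ᵥ x = 0 →
      (∀ i u, C i u → x u = x (w i)) ∧ (∀ u, (∀ i, ¬ C i u) → x u = 0) ∧ ∑ i, x (w i) = 0 := by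
    intro x hx
    have hxv : x v = 0 := by
      have h1 : x ⬝ᵥ A *ᵥ z ![1, 0, 0] = 0 := by
        rw [dotProduct_mulVec, ← mulVec_transpose, hAsymm.eq, hx, zero_dotProduct]
      rw [hAz, dotProduct_neg, dotProduct_single] at h1
      simpa [Fin.sum_univ_three] using h1
    have hsplit : x ⬝ᵥ G.lapMatrix ℝ *ᵥ x + ∑ u, D u * x u ^ 2 = 0 := by
      have h1 : x ⬝ᵥ A *ᵥ x = 0 := by rw [hx, dotProduct_zero]
      rw [sub_mulVec, add_mulVec, hN x hxv, dotProduct_sub, dotProduct_add, dotProduct_single,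
        hxv, zero_mul, sub_zero] at h1
      rw [← h1]
      congr 1
      exact Finset.sum_congr rfl fun u _ => by rw [mulVec_diagonal]; ring
    have hL := (G.posSemidef_lapMatrix ℝ).dotProduct_mulVec_nonneg x
    rw [star_trivial] at hL
    have hDnn : ∀ u, 0 ≤ D u * x u ^ 2 := fun u =>
      mul_nonneg (by simp only [D]; split_ifs <;> norm_num) (sq_nonneg _)
    have hDs := Finset.sum_nonneg fun u (_ : u ∈ Finset.univ) => hDnn u
    have hL0 : Matrix.toLinearMap₂' ℝ (G.lapMatrix ℝ) x x = 0 := by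
      rw [toLinearMap₂'_apply']
      linarith
    have hreach := (G.lapMatrix_toLinearMap₂'_apply'_eq_zero_iff_forall_reachable x).1 hL0
    have hDx : ∀ u, D u * x u = 0 := by
      intro u
      have := (Finset.sum_eq_zero_iff_of_nonneg fun u _ => hDnn u).1
        (show ∑ u, D u * x u ^ 2 = 0 by linarith) u (Finset.mem_univ u)
      simpa using this
    refine ⟨fun i u h => (hreach _ _ h).symm, fun u hu => ?_, ?_⟩
    · by_cases huv : u = v
      · rw [huv, hxv]
      · simpa [show D u = 1 from if_pos ⟨huv, hu⟩] using hDx u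
    · have h1 := hA x hxv (fun i j h => hreach _ _ h.reachable) hDx
      rw [hx] at h1
      simpa using congrFun h1 v
  refine ⟨A, hAS, fun X hX hd _ h0 => ?_, ?_⟩
  · have hcol : ∀ j, A *ᵥ (fun u => X u j) = 0 := fun j =>
      funext fun u => congrFun (congrFun h0 u) j
    have hXs : ∀ i j, X i j = X j i := fun i j => hX.apply j i
    have hS : ∀ k i, X (w k) (w i) = 0 := by
      have h3 : ∀ i, X (w 0) (w i) + X (w 1) (w i) + X (w 2) (w i) = 0 := fun i => by
        rw [← Fin.sum_univ_three fun k => X (w k) (w i)]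
        exact (hker _ (hcol (w i))).2.2
      have e0 := h3 0
      have e1 := h3 1
      have e2 := h3 2
      have s01 := hXs (w 0) (w 1)
      have s02 := hXs (w 0) (w 2)
      have s12 := hXs (w 1) (w 2)
      simp only [hd] at e0 e1 e2
      intro k i
      fin_cases k <;> fin_cases i <;> simp [hd] <;> linarith
    have hrow : ∀ i u, X u (w i) = 0 := by
      intro i u
      by_cases h : ∃ k, C k u
      · obtain ⟨k, hk⟩ := h
        rw [(hker _ (hcol (w i))).1 k u hk, hS]
      · exact (hker _ (hcol (w i))).2.1 u (not_exists.1 h)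
    ext u j
    rw [Matrix.zero_apply]
    by_cases h : ∃ k, C k u
    · obtain ⟨k, hk⟩ := h
      rw [(hker _ (hcol j)).1 k u hk, hXs, hrow]
    · exact (hker _ (hcol j)).2.1 u (not_exists.1 h)
  · have hz : ∀ c : Fin 3 → ℝ, ∑ i, c i = 0 → z c ∈ LinearMap.ker A.mulVecLin := by
      intro c hc
      rw [LinearMap.mem_ker, mulVecLin_apply, hAz, hc, Pi.single_zero, neg_zero]
    have hli : LinearIndependent ℝ
        ![(⟨z ![-1, 1, 0], hz _ (by simp [Fin.sum_univ_three])⟩ : LinearMap.ker A.mulVecLin),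
          ⟨z ![-1, 0, 1], hz _ (by simp [Fin.sum_univ_three])⟩] := by
      refine LinearIndependent.pair_iff.2 fun s t hst => ?_
      have h1 : ∀ u, s * z ![-1, 1, 0] u + t * z ![-1, 0, 1] u = 0 := fun u =>
        congrFun (congrArg Subtype.val hst) u
      have e1 := h1 (w 1)
      have e2 := h1 (w 2)
      simp only [hzw] at e1 e2
      simpa using And.intro e1 e2
    rw [nullity_eq_finrank_ker]
    simpa using hli.fintype_card_le_finrank

lemma xi_eq {n : ℕ} (hle : ∀ A, InS T A → HasSAP A → nullity A ≤ n)
    (hex : ∃ A, InS T A ∧ HasSAP A ∧ n ≤ nullity A) : xi T = n := by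
  obtain ⟨A, hA, hsap, hn⟩ := hex
  refine IsGreatest.csSup_eq ⟨⟨A, hA, hsap, (hle A hA hsap).antisymm hn⟩, ?_⟩
  rintro _ ⟨B, hB, hBsap, rfl⟩
  exact hle B hB hBsap

end Nullity

theorem stmt_14 {V : Type*} [Fintype V] [DecidableEq V] (T : SimpleGraph V)
    (hT : T.IsTree) :
    ((¬ ∃ m : ℕ, Nonempty (T ≃g SimpleGraph.pathGraph m)) → xi T = 2) ∧
    ((∃ m : ℕ, 1 ≤ m ∧ Nonempty (T ≃g SimpleGraph.pathGraph m)) → xi T = 1) ∧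
    xi T ≤ 2 := by
  have hle : ∀ A, InS T A → HasSAP A → nullity A ≤ 2 :=
    fun A hA hsap => hsap.nullity_le_two hA hT
  refine ⟨fun hpath => ?_, ?_, ?_⟩
  · obtain ⟨v, a, b, c, ha, hb, hc, hab, hac, hbc⟩ : ∃ v a b c, T.Adj v a ∧ T.Adj v b ∧
        T.Adj v c ∧ a ≠ b ∧ a ≠ c ∧ b ≠ c := by
      by_contra! hcon
      refine hpath (hT.exists_iso_pathGraph fun v a b c ha hb hc => ?_)
      have := hcon v a b c ha hb hc
      tauto
    refine xi_eq hle (hT.exists_hasSAP_two_le_nullity (v := v) (w := ![a, b, c]) ?_ ?_)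
    · simp [Fin.forall_fin_succ, ha, hb, hc]
    · intro i j hij
      fin_cases i <;> fin_cases j <;> simp_all
  · rintro ⟨m, hm, ⟨f⟩⟩
    exact xi_eq (fun A hA _ => hA.nullity_le_one_of_iso_pathGraph f hm)
      (exists_hasSAP_one_le_nullity hT.connected)
  · refine csSup_le' ?_
    rintro _ ⟨A, hA, hsap, rfl⟩
    exact hle A hA hsap
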